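/- arXiv:2406.12149 — 2 statements merged into one kernel-verified Lean document; each statement's English description precedes it below -/
import Mathlib

section
/- Let P be a length-n ROBP over alphabet {0,1}^k (k ≥ 1) of width w, and let Φ_t be the k-parallel potential of layer t defined from the rectangle labeling of P. Then Φ_{⌊n/10⌋} ≥ 0, and for every ⌊n/10⌋ ≤ t ≤ n−1, Φ_{t+1} − Φ_t ≥ ⌈9k/10⌉ · ((⌊n/10⌋+1)^k − w · 2^k · (⌊n/10⌋+1)^{⌈9k/10⌉−1}). -/
open Finset

/-- A length-`n` read-once branching program over alphabet `σ` with outputs in `Out`.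
Layer `t` has vertex set `Fin (size t)` (only layers `0, 1, …, n` are relevant);
layer `0` consists of a single start vertex, and each vertex of layer `t` has an
outgoing edge to layer `t+1` for every letter of the alphabet. -/
structure ROBP (σ Out : Type) (n : ℕ) where
  size : ℕ → ℕ
  size0 : size 0 = 1
  sizePos : ∀ t, 0 < size t
  step : (t : ℕ) → Fin (size t) → σ → Fin (size (t + 1))
  out : Fin (size n) → Out

namespace ROBP

variable {σ Out : Type} {n : ℕ}

/-- The vertex reached in layer `t` on input `x` (only `x 0, …, x (t-1)` matter). -/
def state (P : ROBP σ Out n) (x : ℕ → σ) : (t : ℕ) → Fin (P.size t)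
  | 0 => ⟨0, P.sizePos 0⟩
  | t + 1 => P.step t (state P x t) (x t)

/-- The width of an ROBP: the maximal number of vertices in a single layer. -/
def width (P : ROBP σ Out n) : ℕ := (Finset.range (n + 1)).sup P.size

/-- Every vertex (in the relevant layers) is reached by some input: no useless vertices. -/
def Reachable (P : ROBP σ Out n) : Prop :=
  ∀ t, t ≤ n → ∀ v : Fin (P.size t), ∃ x : ℕ → σ, P.state x t = v

/-- The output of the program on input `x`. -/
def eval (P : ROBP σ Out n) (x : ℕ → σ) : Out := P.out (P.state x n)

end ROBP

/-- The number of occurrences of `j` among `x 0, …, x (t-1)`. -/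
def countK {k : ℕ} (x : ℕ → Fin k) (t : ℕ) (j : Fin k) : ℕ :=
  ((Finset.range t).filter fun i => x i = j).card

/-- `P` computes `ApproxCount_k[n, Δ]`: on every input, each of the `k` outputs estimates
the frequency of the corresponding letter within additive error `Δ`. -/
def ComputesApproxCountK (k n : ℕ) (Δ : ℝ) (P : ROBP (Fin k) (Fin k → ℝ) n) : Prop :=
  ∀ x : ℕ → Fin k, ∀ j : Fin k, |P.eval x j - (countK x n j : ℝ)| ≤ Δ

/-- `P` computes `ApproxCount[n, Δ]` (the `{0,1}` case). -/
def ComputesApproxCount (n : ℕ) (Δ : ℝ) (P : ROBP Bool ℝ n) : Prop :=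
  ∀ x : ℕ → Bool, |P.eval x - (((Finset.range n).filter fun i => x i = true).card : ℝ)| ≤ Δ

/-- The number of `1`'s in coordinate `j` among `x 0, …, x (t-1)`. -/
def countPar {k : ℕ} (x : ℕ → (Fin k → Bool)) (t : ℕ) (j : Fin k) : ℕ :=
  ((Finset.range t).filter fun i => x i j = true).card

/-- `P` computes `ApproxCount^par_k[n, Δ]`. -/
def ComputesApproxCountPar (k n : ℕ) (Δ : ℝ) (P : ROBP (Fin k → Bool) (Fin k → ℝ) n) : Prop :=
  ∀ x : ℕ → (Fin k → Bool), ∀ j : Fin k, |P.eval x j - (countPar x n j : ℝ)| ≤ Δ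

/-- The inclusion `[k-1] ⊆ [k]`. -/
def idx {k : ℕ} (j : Fin (k - 1)) : Fin k := Fin.castLE (Nat.sub_le k 1) j

/-- `a_j(v)`: the minimal possible number of `j`'s in the first `t` input words
reaching the vertex `v` of layer `t`. -/
noncomputable def rectLo {k n : ℕ} (P : ROBP (Fin k) (Fin k → ℝ) n) (t : ℕ)
    (v : Fin (P.size t)) (j : Fin (k - 1)) : ℕ :=
  sInf {c | ∃ x : ℕ → Fin k, P.state x t = v ∧ countK x t (idx j) = c}

/-- `b_j(v)`: the maximal possible number of `j`'s in the first `t` input words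
reaching the vertex `v` of layer `t`. -/
noncomputable def rectHi {k n : ℕ} (P : ROBP (Fin k) (Fin k → ℝ) n) (t : ℕ)
    (v : Fin (P.size t)) (j : Fin (k - 1)) : ℕ :=
  sSup {c | ∃ x : ℕ → Fin k, P.state x t = v ∧ countK x t (idx j) = c}

/-- `a_j(v)` for the `k`-parallel case. -/
noncomputable def parLo {k n : ℕ} (P : ROBP (Fin k → Bool) (Fin k → ℝ) n) (t : ℕ)
    (v : Fin (P.size t)) (j : Fin k) : ℕ :=
  sInf {c | ∃ x : ℕ → (Fin k → Bool), P.state x t = v ∧ countPar x t j = c}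

/-- `b_j(v)` for the `k`-parallel case. -/
noncomputable def parHi {k n : ℕ} (P : ROBP (Fin k → Bool) (Fin k → ℝ) n) (t : ℕ)
    (v : Fin (P.size t)) (j : Fin k) : ℕ :=
  sSup {c | ∃ x : ℕ → (Fin k → Bool), P.state x t = v ∧ countPar x t j = c}

/-- The axis-parallel box `[lo 1, hi 1] × ⋯ × [lo m, hi m]` (as a set of integer points). -/
def rect {m : ℕ} (lo hi : Fin m → ℕ) : Set (Fin m → ℕ) :=
  {y | ∀ j, lo j ≤ y j ∧ y j ≤ hi j}

/-- The potential `φ_t(x)` of the point `x` (k-counter case): the maximum, over all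
rectangle labels of layer `t` containing `x`, of `min{Σ_j b_j, t} - Σ_j x_j`. -/
noncomputable def phiK {k n : ℕ} (P : ROBP (Fin k) (Fin k → ℝ) n) (t : ℕ)
    (x : Fin (k - 1) → ℕ) : ℕ :=
  Finset.univ.sup fun v : Fin (P.size t) =>
    if ∀ j, rectLo P t v j ≤ x j ∧ x j ≤ rectHi P t v j then
      min (∑ j, rectHi P t v j) t - ∑ j, x j
    else 0

/-- `T_{t,k}`: tuples of naturals summing to at most `t`. -/
def Tset (k t : ℕ) : Finset (Fin (k - 1) → ℕ) :=
  (Fintype.piFinset fun _ => Finset.range (t + 1)).filter fun x => ∑ j, x j ≤ t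

/-- The total potential `Φ_t` of layer `t` (k-counter case). -/
noncomputable def PhiK {k n : ℕ} (P : ROBP (Fin k) (Fin k → ℝ) n) (t : ℕ) : ℕ :=
  ∑ x ∈ Tset k t, phiK P t x

/-- The potential `φ_t(x)` of the point `x` (k-parallel case). -/
noncomputable def phiPar {k n : ℕ} (P : ROBP (Fin k → Bool) (Fin k → ℝ) n) (t : ℕ)
    (x : Fin k → ℕ) : ℕ :=
  Finset.univ.sup fun v : Fin (P.size t) =>
    if ∀ j, parLo P t v j ≤ x j ∧ x j ≤ parHi P t v j then
      (∑ j, parHi P t v j) - ∑ j, x j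
    else 0

/-- The total potential `Φ_t` of layer `t` (k-parallel case): the sum of `φ_t(x)`
over `x ∈ {0, 1, …, ⌊n/10⌋}^k`. -/
noncomputable def PhiPar {k n : ℕ} (P : ROBP (Fin k → Bool) (Fin k → ℝ) n) (t : ℕ) : ℕ :=
  ∑ x ∈ Fintype.piFinset (fun _ : Fin k => Finset.range (n / 10 + 1)), phiPar P t x

/-- The generalized binomial coefficient `C(x, m) = x (x-1) ⋯ (x-m+1) / m!`. -/
noncomputable def genChoose (x : ℝ) (m : ℕ) : ℝ :=
  (∏ i ∈ Finset.range m, (x - (i : ℝ))) / (Nat.factorial m : ℝ)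

namespace ROBP

/-- The state in layer `t` depends only on the first `t` letters of the input. -/
theorem state_congr {σ Out : Type} {n : ℕ} (P : ROBP σ Out n) {x y : ℕ → σ} {t : ℕ}
    (h : ∀ i < t, x i = y i) : P.state x t = P.state y t := by
  induction t with
  | zero => rfl
  | succ t ih =>
    simp only [state]
    rw [ih fun i hi => h i (by omega), h t (by omega)]

theorem state_update_succ {σ Out : Type} {n : ℕ} (P : ROBP σ Out n) (x : ℕ → σ) (t : ℕ) (y : σ) :
    P.state (Function.update x t y) (t + 1) = P.step t (P.state x t) y := by
  simp only [state, Function.update_self]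
  rw [P.state_congr fun i hi => Function.update_of_ne hi.ne y x]

theorem size_le_width {σ Out : Type} {n : ℕ} (P : ROBP σ Out n) {t : ℕ} (ht : t ≤ n) :
    P.size t ≤ P.width :=
  Finset.le_sup (f := P.size) (Finset.mem_range.2 (by omega))

end ROBP

theorem countPar_le {k : ℕ} (x : ℕ → (Fin k → Bool)) (t : ℕ) (j : Fin k) :
    countPar x t j ≤ t :=
  (Finset.card_filter_le _ _).trans_eq (Finset.card_range t)

theorem countPar_update_succ {k : ℕ} (x : ℕ → (Fin k → Bool)) (t : ℕ) (y : Fin k → Bool)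
    (j : Fin k) :
    countPar (Function.update x t y) (t + 1) j = countPar x t j + (y j).toNat := by
  have h : ((Finset.range t).filter fun i => Function.update x t y i j = true) =
      (Finset.range t).filter fun i => x i j = true := by
    refine Finset.filter_congr fun i hi => ?_
    rw [Function.update_of_ne (Finset.mem_range.1 hi).ne]
  unfold countPar
  rw [Finset.range_add_one, Finset.filter_insert, h, Function.update_self]
  cases y j <;> simp

/-- Every vector of counts at most `t` is realised by some input. -/
theorem countPar_decide_lt {k : ℕ} (c : Fin k → ℕ) {t : ℕ} (j : Fin k) (h : c j ≤ t) :
    countPar (fun i j => decide (i < c j)) t j = c j := by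
  have : ((Finset.range t).filter fun i => decide (i < c j) = true) = Finset.range (c j) := by
    ext i
    simp only [Finset.mem_filter, Finset.mem_range, decide_eq_true_eq]
    omega
  rw [countPar, this, Finset.card_range]

section Rectangle

variable {k n : ℕ} (P : ROBP (Fin k → Bool) (Fin k → ℝ) n)

theorem parLo_le (x : ℕ → (Fin k → Bool)) (t : ℕ) (j : Fin k) :
    parLo P t (P.state x t) j ≤ countPar x t j :=
  Nat.sInf_le ⟨x, rfl, rfl⟩

theorem bddAbove_countPar (t : ℕ) (v : Fin (P.size t)) (j : Fin k) :
    BddAbove {c | ∃ x : ℕ → (Fin k → Bool), P.state x t = v ∧ countPar x t j = c} :=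
  ⟨t, by rintro _ ⟨x, -, rfl⟩; exact countPar_le x t j⟩

theorem le_parHi (x : ℕ → (Fin k → Bool)) (t : ℕ) (j : Fin k) :
    countPar x t j ≤ parHi P t (P.state x t) j :=
  le_csSup (bddAbove_countPar P t _ j) ⟨x, rfl, rfl⟩

variable {P}

theorem exists_countPar_eq_parLo (hreach : P.Reachable) {t : ℕ} (ht : t ≤ n)
    (v : Fin (P.size t)) (j : Fin k) :
    ∃ x : ℕ → (Fin k → Bool), P.state x t = v ∧ countPar x t j = parLo P t v j :=
  let ⟨x, hx⟩ := hreach t ht v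
  Nat.sInf_mem (s := {c | ∃ x : ℕ → (Fin k → Bool), P.state x t = v ∧ countPar x t j = c})
    ⟨_, x, hx, rfl⟩

theorem exists_countPar_eq_parHi (hreach : P.Reachable) {t : ℕ} (ht : t ≤ n)
    (v : Fin (P.size t)) (j : Fin k) :
    ∃ x : ℕ → (Fin k → Bool), P.state x t = v ∧ countPar x t j = parHi P t v j :=
  let ⟨x, hx⟩ := hreach t ht v
  Nat.sSup_mem (s := {c | ∃ x : ℕ → (Fin k → Bool), P.state x t = v ∧ countPar x t j = c})
    ⟨_, x, hx, rfl⟩ (bddAbove_countPar P t v j)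

theorem parLo_step_le (hreach : P.Reachable) {t : ℕ} (ht : t ≤ n) (v : Fin (P.size t))
    (y : Fin k → Bool) (j : Fin k) :
    parLo P (t + 1) (P.step t v y) j ≤ parLo P t v j + (y j).toNat := by
  obtain ⟨x, rfl, hx⟩ := exists_countPar_eq_parLo hreach ht v j
  have h := parLo_le P (Function.update x t y) (t + 1) j
  rwa [P.state_update_succ, countPar_update_succ, hx] at h

theorem le_parHi_step (hreach : P.Reachable) {t : ℕ} (ht : t ≤ n) (v : Fin (P.size t))
    (y : Fin k → Bool) (j : Fin k) :
    parHi P t v j + (y j).toNat ≤ parHi P (t + 1) (P.step t v y) j := by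
  obtain ⟨x, rfl, hx⟩ := exists_countPar_eq_parHi hreach ht v j
  have h := le_parHi P (Function.update x t y) (t + 1) j
  rwa [P.state_update_succ, countPar_update_succ, hx] at h

/-- A point with entries at most `t` lies in the rectangle of some vertex of layer `t`. -/
theorem exists_mem_rectangle (P : ROBP (Fin k → Bool) (Fin k → ℝ) n) {t : ℕ} (c : Fin k → ℕ)
    (hc : ∀ j, c j ≤ t) :
    ∃ v : Fin (P.size t), ∀ j, parLo P t v j ≤ c j ∧ c j ≤ parHi P t v j := by
  refine ⟨P.state (fun i j => decide (i < c j)) t, fun j => ?_⟩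
  have h := countPar_decide_lt c j (hc j)
  have hlo := parLo_le P (fun i j => decide (i < c j)) t j
  have hhi := le_parHi P (fun i j => decide (i < c j)) t j
  rw [h] at hlo hhi
  exact ⟨hlo, hhi⟩

theorem le_phiPar {t : ℕ} {c : Fin k → ℕ} (v : Fin (P.size t))
    (hv : ∀ j, parLo P t v j ≤ c j ∧ c j ≤ parHi P t v j) :
    (∑ j, parHi P t v j) - ∑ j, c j ≤ phiPar P t c := by
  have h := Finset.le_sup (s := Finset.univ) (f := fun v : Fin (P.size t) =>
    if ∀ j, parLo P t v j ≤ c j ∧ c j ≤ parHi P t v j then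
      (∑ j, parHi P t v j) - ∑ j, c j else 0) (Finset.mem_univ v)
  simp only [if_pos hv] at h
  exact h

/-- The maximum defining `phiPar` is attained at a rectangle containing the point. -/
theorem exists_phiPar_eq (P : ROBP (Fin k → Bool) (Fin k → ℝ) n) {t : ℕ} (c : Fin k → ℕ)
    (hc : ∀ j, c j ≤ t) :
    ∃ v : Fin (P.size t), (∀ j, parLo P t v j ≤ c j ∧ c j ≤ parHi P t v j) ∧
      phiPar P t c = (∑ j, parHi P t v j) - ∑ j, c j := by
  obtain ⟨u, hu⟩ := exists_mem_rectangle P c hc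
  obtain ⟨v, -, hv⟩ := Finset.exists_mem_eq_sup Finset.univ ⟨u, Finset.mem_univ u⟩
    (fun v : Fin (P.size t) =>
      if ∀ j, parLo P t v j ≤ c j ∧ c j ≤ parHi P t v j then
        (∑ j, parHi P t v j) - ∑ j, c j else 0)
  change phiPar P t c = _ at hv
  by_cases hmem : ∀ j, parLo P t v j ≤ c j ∧ c j ≤ parHi P t v j
  · exact ⟨v, hmem, by simpa only [if_pos hmem] using hv⟩
  · rw [if_neg hmem] at hv
    exact ⟨u, hu, by have := le_phiPar u hu; omega⟩

/-- From layer `t` to layer `t + 1`, the potential of a point grows by at least the number of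
coordinates in which it differs from the lower corner of a maximising rectangle. -/
theorem exists_phiPar_add_card_le (hreach : P.Reachable) {t : ℕ} (ht : t ≤ n) (c : Fin k → ℕ)
    (hc : ∀ j, c j ≤ t) :
    ∃ v : Fin (P.size t),
      phiPar P t c + (Finset.univ.filter fun j => c j ≠ parLo P t v j).card ≤
        phiPar P (t + 1) c := by
  obtain ⟨v, hv, hphi⟩ := exists_phiPar_eq P c hc
  refine ⟨v, ?_⟩
  set y : Fin k → Bool := fun j => decide (c j ≠ parLo P t v j) with hy
  have hyj : ∀ j, (y j).toNat = if c j ≠ parLo P t v j then 1 else 0 := fun j => by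
    by_cases h : c j = parLo P t v j <;> simp [hy, h]
  have hstep : ∀ j, parLo P (t + 1) (P.step t v y) j ≤ c j ∧
      c j ≤ parHi P (t + 1) (P.step t v y) j := fun j => by
    have hlo := parLo_step_le hreach ht v y j
    have hhi := le_parHi_step hreach ht v y j
    have := hv j
    rw [hyj j] at hlo
    split_ifs at hlo <;> omega
  have hsum : (∑ j, parHi P t v j) + (Finset.univ.filter fun j => c j ≠ parLo P t v j).card ≤
      ∑ j, parHi P (t + 1) (P.step t v y) j := by
    rw [Finset.card_filter, ← Finset.sum_add_distrib]
    refine Finset.sum_le_sum fun j _ => ?_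
    rw [← hyj j]
    exact le_parHi_step hreach ht v y j
  have hle : ∑ j, c j ≤ ∑ j, parHi P t v j := Finset.sum_le_sum fun j _ => (hv j).2
  have := le_phiPar _ hstep
  omega

end Rectangle

/-- The number of points of a cube of side `m` that differ from a given point in at most `d`
coordinates. -/
theorem card_filter_card_ne_le {ι : Type*} [Fintype ι] [DecidableEq ι] (a : ι → ℕ) {m : ℕ}
    (hm : 0 < m) (d : ℕ) :
    ((Fintype.piFinset fun _ : ι => Finset.range m).filter fun x =>
      (Finset.univ.filter fun j => x j ≠ a j).card ≤ d).card ≤ 2 ^ Fintype.card ι * m ^ d := by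
  have hsub : ((Fintype.piFinset fun _ : ι => Finset.range m).filter fun x =>
      (Finset.univ.filter fun j => x j ≠ a j).card ≤ d) ⊆
      ((Finset.univ : Finset (Finset ι)).filter fun S => S.card ≤ d).biUnion fun S =>
        Fintype.piFinset fun j => if j ∈ S then Finset.range m else {a j} := by
    intro x hx
    obtain ⟨hx, hd⟩ := Finset.mem_filter.1 hx
    refine Finset.mem_biUnion.2 ⟨_, Finset.mem_filter.2 ⟨Finset.mem_univ _, hd⟩, ?_⟩
    refine Fintype.mem_piFinset.2 fun j => ?_
    have := Fintype.mem_piFinset.1 hx j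
    by_cases h : x j = a j <;> simp_all
  calc _ ≤ _ := Finset.card_le_card hsub
    _ ≤ ((Finset.univ : Finset (Finset ι)).filter fun S => S.card ≤ d).card * m ^ d := by
      refine Finset.card_biUnion_le_card_mul _ _ _ fun S hS => ?_
      rw [Fintype.card_piFinset]
      simp only [apply_ite Finset.card, Finset.card_range, Finset.card_singleton,
        Finset.prod_ite_mem, Finset.univ_inter, Finset.prod_const]
      exact Nat.pow_le_pow_right hm (Finset.mem_filter.1 hS).2
    _ ≤ _ := by
      refine Nat.mul_le_mul_right _ ((Finset.card_filter_le _ _).trans_eq ?_)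
      rw [Finset.card_univ, Fintype.card_finset]

/-- The potential grows by at least `d + 1` at all but a few points of the cube. -/
theorem PhiPar_succ_ge {k n : ℕ} {P : ROBP (Fin k → Bool) (Fin k → ℝ) n} (hreach : P.Reachable)
    (d : ℕ) {t : ℕ} (hle : n / 10 ≤ t) (ht : t ≤ n) :
    PhiPar P t + (d + 1) * (n / 10 + 1) ^ k ≤
      PhiPar P (t + 1) + (d + 1) * (P.width * 2 ^ k * (n / 10 + 1) ^ d) := by
  set m := n / 10 + 1 with hm
  set box := Fintype.piFinset fun _ : Fin k => Finset.range m with hbox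
  set bad : Finset (Fin k → ℕ) := (Finset.univ : Finset (Fin (P.size t))).biUnion fun v =>
    box.filter fun x => (Finset.univ.filter fun j => x j ≠ parLo P t v j).card ≤ d
  have hbad_card : bad.card ≤ P.width * 2 ^ k * m ^ d := by
    calc bad.card ≤ (Finset.univ : Finset (Fin (P.size t))).card * (2 ^ k * m ^ d) :=
          Finset.card_biUnion_le_card_mul _ _ _ fun v _ => by
            simpa using card_filter_card_ne_le (parLo P t v) (by omega : 0 < m) d
      _ ≤ P.width * 2 ^ k * m ^ d := by
          rw [Finset.card_univ, Fintype.card_fin, mul_assoc]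
          exact Nat.mul_le_mul_right _ (P.size_le_width ht)
  have hbad_sub : bad ⊆ box := Finset.biUnion_subset.2 fun v _ => Finset.filter_subset _ _
  have hpoint : ∀ x ∈ box, phiPar P t x + (d + 1) ≤
      phiPar P (t + 1) x + if x ∈ bad then d + 1 else 0 := by
    intro x hx
    have hxt : ∀ j, x j ≤ t := fun j => by
      have := Finset.mem_range.1 (Fintype.mem_piFinset.1 hx j)
      omega
    obtain ⟨v, hv⟩ := exists_phiPar_add_card_le hreach ht x hxt
    split_ifs with hxbad
    · omega
    · have : ¬ (Finset.univ.filter fun j => x j ≠ parLo P t v j).card ≤ d := fun h =>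
        hxbad (Finset.mem_biUnion.2 ⟨v, Finset.mem_univ v, Finset.mem_filter.2 ⟨hx, h⟩⟩)
      omega
  have hsum := Finset.sum_le_sum hpoint
  rw [Finset.sum_add_distrib (f := phiPar P t), Finset.sum_add_distrib (f := phiPar P (t + 1)),
    Finset.sum_const, Finset.sum_ite_mem,
    Finset.inter_eq_right.2 hbad_sub, Finset.sum_const, smul_eq_mul, smul_eq_mul,
    hbox, Fintype.card_piFinset_const, Finset.card_range] at hsum
  calc _ = PhiPar P t + m ^ k * (d + 1) := by rw [mul_comm]
    _ ≤ PhiPar P (t + 1) + bad.card * (d + 1) := hsum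
    _ ≤ _ := by
      rw [mul_comm bad.card]
      gcongr

/-- Growth of the potential, `k`-parallel case:
`Φ_{⌊n/10⌋} ≥ 0`, and for every `⌊n/10⌋ ≤ t ≤ n-1`,
`Φ_{t+1} - Φ_t ≥ ⌈9k/10⌉ · ((⌊n/10⌋+1)^k - w · 2^k · (⌊n/10⌋+1)^{⌈9k/10⌉-1})`,
where `w` is the width of `P`.  (Here `⌈9k/10⌉ = (9k+9)/10` in ℕ-division.) -/
theorem stmt12 (k n : ℕ) (hk : 1 ≤ k)
    (P : ROBP (Fin k → Bool) (Fin k → ℝ) n) (hreach : P.Reachable) :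
    0 ≤ (PhiPar P (n / 10) : ℤ) ∧
    ∀ t, n / 10 ≤ t → t < n →
      (PhiPar P (t + 1) : ℤ) - (PhiPar P t : ℤ) ≥
        (((9 * k + 9) / 10 : ℕ) : ℤ) *
          (((n / 10 + 1 : ℕ) : ℤ) ^ k -
            (P.width : ℤ) * 2 ^ k * ((n / 10 + 1 : ℕ) : ℤ) ^ ((9 * k + 9) / 10 - 1)) := by
  refine ⟨by positivity, fun t hle ht => ?_⟩
  obtain ⟨d, hd⟩ : ∃ d, (9 * k + 9) / 10 = d + 1 := ⟨(9 * k + 9) / 10 - 1, by omega⟩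
  have h := PhiPar_succ_ge hreach d hle ht.le
  rw [hd, Nat.add_sub_cancel, mul_sub]
  zify at h
  push_cast at h ⊢
  linarith
end

section
/- There exist absolute constants c_1, c_2 > 0 such that for all integers k ≥ 2, n ≥ 10k and every real Δ with 10 ≤ Δ ≤ n/(10k²) the following holds. Let w(k,n,Δ) be the minimum width over all length-n ROBPs over alphabet [k] that compute ApproxCount_k[n,Δ]. Then C(n + k − 1 − c_2·√(nΔ), k−1) ≤ w(k,n,Δ) ≤ C(n + k − 1 − c_1·√(nΔ), k−1), where C(x,k−1) denotes the generalized binomial coefficient x(x−1)⋯(x−k+2)/(k−1)! for a real x. -/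
open Finset

/-- `w(k,n,Δ)`: the minimum width over all length-`n` ROBPs over `[k]` that compute
`ApproxCount_k[n,Δ]`. -/
noncomputable def widthOpt (k n : ℕ) (Δ : ℝ) : ℕ :=
  sInf {w : ℕ | ∃ P : ROBP (Fin k) (Fin k → ℝ) n, P.Reachable ∧
    ComputesApproxCountK k n Δ P ∧ P.width = w}

theorem card_Tset (k t : ℕ) : (Tset k t).card = (t + (k - 1)).choose (k - 1) := by
  have h : (Tset k t).card = ∑ i ∈ range (t + 1),
      (finsuppAntidiag (univ : Finset (Fin (k - 1))) i).card := by
    rw [Finset.card_eq_sum_card_fiberwise (f := fun x => ∑ j, x j) (t := range (t + 1))]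
    · refine Finset.sum_congr rfl fun i hi => ?_
      refine Finset.card_bij' (fun x _ => Finsupp.equivFunOnFinite.symm x) (fun f _ => ⇑f)
        ?_ ?_ ?_ ?_
      · intro x hx
        simp only [mem_filter] at hx
        simp [hx.2]
      · intro f hf
        simp only [mem_finsuppAntidiag, subset_univ, and_true, mem_range] at hf hi
        have hle : ∀ j, f j ≤ i := fun j => hf ▸ Finset.single_le_sum
          (f := fun j => f j) (fun _ _ => Nat.zero_le _) (mem_univ j)
        simp only [Tset, mem_filter, Fintype.mem_piFinset, mem_range]
        exact ⟨⟨fun j => by have := hle j; omega, hf.trans_le (by omega)⟩, hf⟩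
      · intro x _
        rfl
      · intro f _
        ext
        rfl
    · intro x hx
      simp only [Tset, coe_filter, Set.mem_ofPred_eq] at hx
      simpa [Nat.lt_succ_iff] using hx.2
  rw [h]
  simp only [card_finsuppAntidiag_nat_eq_multichoose, card_univ, Fintype.card_fin]
  exact Nat.sum_range_multichoose t (k - 1)

theorem mem_Tset {k t : ℕ} {x : Fin (k - 1) → ℕ} : x ∈ Tset k t ↔ ∑ j, x j ≤ t := by
  simp only [Tset, mem_filter, Fintype.mem_piFinset, mem_range, and_iff_right_iff_imp]
  intro h j
  have := Finset.single_le_sum (f := x) (fun _ _ => Nat.zero_le _) (mem_univ j)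
  omega

theorem genChoose_natCast (t m : ℕ) : genChoose ((t : ℝ) + m) m = ((t + m).choose m : ℝ) := by
  have h : ∏ i ∈ range m, ((t : ℝ) + m - i) = ((t + m).descFactorial m : ℝ) := by
    rw [Nat.descFactorial_eq_prod_range, Nat.cast_prod]
    refine Finset.prod_congr rfl fun i hi => ?_
    have := mem_range.1 hi
    rw [Nat.cast_sub (by omega), Nat.cast_add]
  rw [genChoose, h, Nat.descFactorial_eq_factorial_mul_choose, Nat.cast_mul,
    mul_div_cancel_left₀ _ (Nat.cast_ne_zero.2 (Nat.factorial_ne_zero m))]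

theorem genChoose_mono {x y : ℝ} {m : ℕ} (hx : (m : ℝ) - 1 ≤ x) (hxy : x ≤ y) :
    genChoose x m ≤ genChoose y m := by
  unfold genChoose
  refine div_le_div_of_nonneg_right (Finset.prod_le_prod (fun i hi => ?_) fun i _ => ?_)
    (Nat.cast_nonneg _)
  · have : ((i + 1 : ℕ) : ℝ) ≤ m := Nat.cast_le.2 (mem_range.1 hi)
    push_cast at this
    linarith
  · linarith

/-- Bernoulli-type lower bound for a shifted generalized binomial coefficient. -/
theorem genChoose_sub_ge {x y a : ℝ} {m : ℕ} (ha : 0 < a) (hy : 0 ≤ y) (hya : y ≤ a)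
    (hx : a + m ≤ x + 1) : genChoose x m * (1 - m * y / a) ≤ genChoose (x - y) m := by
  have key : ∀ j ≤ m, 0 ≤ ∏ i ∈ range j, (x - i) ∧ 0 ≤ ∏ i ∈ range j, (x - y - i) ∧
      (∏ i ∈ range j, (x - i)) * (1 - j * y / a) ≤ ∏ i ∈ range j, (x - y - i) := by
    intro j
    induction j with
    | zero => intro _; simp
    | succ j ih =>
      intro hj
      obtain ⟨h0, h1, h2⟩ := ih (by omega)
      have hjm : (j : ℝ) + 1 ≤ m := by exact_mod_cast hj
      have hxj : a ≤ x - j := by linarith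
      have hxyj : 0 ≤ x - y - j := by linarith
      rw [prod_range_succ, prod_range_succ]
      refine ⟨mul_nonneg h0 (by linarith), mul_nonneg h1 hxyj, ?_⟩
      refine le_trans ?_ (mul_le_mul_of_nonneg_right h2 hxyj)
      rw [mul_assoc, mul_assoc]
      refine mul_le_mul_of_nonneg_left ?_ h0
      have hya' : 0 ≤ y / a := by positivity
      have e1 : ((j + 1 : ℕ) : ℝ) * y / a = j * (y / a) + y / a := by push_cast; ring
      have e2 : (j : ℝ) * y / a = j * (y / a) := by ring
      have e3 : y = y / a * a := by field_simp
      rw [e1, e2]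
      have h3 : 0 ≤ (j : ℝ) * (y / a) := by positivity
      generalize y / a = q at *
      subst e3
      nlinarith [mul_nonneg hya' (sub_nonneg.2 hxj), mul_nonneg h3 (mul_nonneg hya' ha.le)]
  unfold genChoose
  rw [div_mul_eq_mul_div]
  gcongr
  exact (key m le_rfl).2.2

theorem genChoose_sub_le {x y : ℝ} {m : ℕ} (hx : 0 < x) (hy : 0 ≤ y)
    (hxy : (m : ℝ) ≤ x - y + 1) : genChoose (x - y) m ≤ genChoose x m * (1 - y / x) ^ m := by
  unfold genChoose
  rw [div_mul_eq_mul_div]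
  gcongr
  calc ∏ i ∈ range m, (x - y - i) ≤ ∏ i ∈ range m, ((x - i) * (1 - y / x)) := by
        refine Finset.prod_le_prod (fun i hi => ?_) (fun i hi => ?_)
        · have : ((i + 1 : ℕ) : ℝ) ≤ m := Nat.cast_le.2 (mem_range.1 hi)
          push_cast at this
          linarith
        · have h1 : (x - i) * (1 - y / x) = x - y - i + i * (y / x) := by field_simp; ring
          have : 0 ≤ (i : ℝ) * (y / x) := by positivity
          linarith
    _ = _ := by rw [prod_mul_distrib, prod_const, card_range]

section Counting

variable {k : ℕ}

theorem countK_succ (x : ℕ → Fin k) (t : ℕ) (j : Fin k) :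
    countK x (t + 1) j = countK x t j + if x t = j then 1 else 0 := by
  unfold countK
  rw [range_add_one, filter_insert]
  split_ifs with h
  · rw [card_insert_of_notMem (by simp)]
  · rfl

theorem countK_congr {x y : ℕ → Fin k} {t : ℕ} (h : ∀ i < t, x i = y i) (j : Fin k) :
    countK x t j = countK y t j := by
  unfold countK
  congr 1
  exact filter_congr fun i hi => by rw [h i (mem_range.1 hi)]

theorem countK_update (x : ℕ → Fin k) (t : ℕ) (l j : Fin k) :
    countK (Function.update x t l) (t + 1) j = countK x t j + if l = j then 1 else 0 := by
  have h : countK (Function.update x t l) t j = countK x t j :=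
    countK_congr (fun i hi => by rw [Function.update_of_ne (Nat.ne_of_lt hi)]) j
  rw [countK_succ, Function.update_self, h]

theorem countK_le (x : ℕ → Fin k) (t : ℕ) (j : Fin k) : countK x t j ≤ t :=
  (card_filter_le _ _).trans_eq (card_range t)

theorem sum_countK (x : ℕ → Fin k) (t : ℕ) : ∑ j, countK x t j = t := by
  simpa [countK] using
    (Finset.card_eq_sum_card_fiberwise (f := x) (s := range t) (t := univ) (by simp)).symm

theorem idx_injective : Function.Injective (idx (k := k)) := Fin.castLE_injective (Nat.sub_le k 1)

theorem sum_eq_sum_idx_add {M : Type*} [AddCommMonoid M] (hk : 1 ≤ k) (f : Fin k → M) :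
    ∑ l, f l = (∑ j, f (idx j)) + f ⟨k - 1, by omega⟩ := by
  obtain ⟨m, rfl⟩ : ∃ m, k = m + 1 := ⟨k - 1, by omega⟩
  exact Fin.sum_univ_castSucc f

theorem sum_countK_idx_le (x : ℕ → Fin k) (t : ℕ) : ∑ j, countK x t (idx j) ≤ t := by
  obtain hk | hk := Nat.eq_zero_or_pos k
  · subst hk
    exact (x 0).elim0
  · have h := sum_countK x t
    rw [sum_eq_sum_idx_add hk] at h
    omega

/-- Every point of the simplex is the count vector of some input. -/
theorem exists_countK_eq (hk : 1 ≤ k) (t : ℕ) (y : Fin (k - 1) → ℕ) (hy : ∑ j, y j ≤ t) :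
    ∃ x : ℕ → Fin k, ∀ j, countK x t (idx j) = y j := by
  induction t generalizing y with
  | zero =>
    refine ⟨fun _ => ⟨0, hk⟩, fun j => ?_⟩
    have := Finset.single_le_sum (f := y) (fun _ _ => Nat.zero_le _) (mem_univ j)
    simp [countK]
    omega
  | succ t ih =>
    by_cases h0 : ∀ j, y j = 0
    · obtain ⟨x, hx⟩ := ih y (by simp [h0])
      refine ⟨Function.update x t ⟨k - 1, by omega⟩, fun j => ?_⟩
      rw [countK_update, hx, if_neg, add_zero]
      intro h
      have := congrArg Fin.val h
      simp [idx] at this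
      omega
    · push Not at h0
      obtain ⟨i, hi⟩ := h0
      have hsum : ∑ j, y j = (∑ j, Function.update y i (y i - 1) j) + 1 := by
        have h1 := Finset.sum_update_of_mem (mem_univ i) y (y i - 1)
        have h2 := Finset.add_sum_erase univ y (mem_univ i)
        rw [Finset.sdiff_singleton_eq_erase] at h1
        omega
      obtain ⟨x, hx⟩ := ih (Function.update y i (y i - 1)) (by omega)
      refine ⟨Function.update x t (idx i), fun j => ?_⟩
      rw [countK_update, hx]
      by_cases hij : i = j
      · subst hij
        rw [Function.update_self, if_pos rfl]
        omega
      · rw [Function.update_of_ne (Ne.symm hij), if_neg fun h => hij (idx_injective h), add_zero]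

end Counting

section Potential

variable {k n : ℕ} (P : ROBP (Fin k) (Fin k → ℝ) n)

theorem ROBP.state_congr_s17 {σ Out : Type} {n : ℕ} (P : ROBP σ Out n) {x y : ℕ → σ} {t : ℕ}
    (h : ∀ i < t, x i = y i) : P.state x t = P.state y t := by
  induction t with
  | zero => rfl
  | succ t ih =>
    simp only [ROBP.state]
    rw [ih fun i hi => h i (by omega), h t (by omega)]

theorem ROBP.state_update {σ Out : Type} {n : ℕ} (P : ROBP σ Out n) (x : ℕ → σ) (t : ℕ) (l : σ) :
    P.state (Function.update x t l) (t + 1) = P.step t (P.state x t) l := by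
  simp only [ROBP.state]
  rw [Function.update_self,
    P.state_congr_s17 fun i hi => Function.update_of_ne (Nat.ne_of_lt hi) l x]

variable {P}

theorem rectLo_le {x : ℕ → Fin k} {t : ℕ} {v : Fin (P.size t)} (hx : P.state x t = v)
    (j : Fin (k - 1)) : rectLo P t v j ≤ countK x t (idx j) :=
  Nat.sInf_le ⟨x, hx, rfl⟩

theorem bddAbove_counts (t : ℕ) (v : Fin (P.size t)) (j : Fin (k - 1)) :
    BddAbove {c | ∃ x : ℕ → Fin k, P.state x t = v ∧ countK x t (idx j) = c} :=
  ⟨t, by rintro _ ⟨x, _, rfl⟩; exact countK_le x t _⟩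

theorem le_rectHi {x : ℕ → Fin k} {t : ℕ} {v : Fin (P.size t)} (hx : P.state x t = v)
    (j : Fin (k - 1)) : countK x t (idx j) ≤ rectHi P t v j :=
  le_csSup (bddAbove_counts t v j) ⟨x, hx, rfl⟩

theorem exists_rectLo (hP : P.Reachable) {t : ℕ} (ht : t ≤ n) (v : Fin (P.size t))
    (j : Fin (k - 1)) : ∃ x : ℕ → Fin k, P.state x t = v ∧ countK x t (idx j) = rectLo P t v j := by
  obtain ⟨x, hx⟩ := hP t ht v
  exact Nat.sInf_mem (s := {c | ∃ x : ℕ → Fin k, P.state x t = v ∧ countK x t (idx j) = c})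
    ⟨_, x, hx, rfl⟩

theorem exists_rectHi (hP : P.Reachable) {t : ℕ} (ht : t ≤ n) (v : Fin (P.size t))
    (j : Fin (k - 1)) : ∃ x : ℕ → Fin k, P.state x t = v ∧ countK x t (idx j) = rectHi P t v j := by
  obtain ⟨x, hx⟩ := hP t ht v
  exact Nat.sSup_mem (s := {c | ∃ x : ℕ → Fin k, P.state x t = v ∧ countK x t (idx j) = c})
    ⟨_, x, hx, rfl⟩ (bddAbove_counts t v j)

theorem rectLo_step_le (hP : P.Reachable) {t : ℕ} (ht : t ≤ n) (v : Fin (P.size t)) (l : Fin k)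
    (j : Fin (k - 1)) :
    rectLo P (t + 1) (P.step t v l) j ≤ rectLo P t v j + if l = idx j then 1 else 0 := by
  obtain ⟨x, hx, hc⟩ := exists_rectLo hP ht v j
  rw [← hc, ← countK_update, ← hx, ← P.state_update]
  exact rectLo_le rfl j

theorem rectHi_add_le_step (hP : P.Reachable) {t : ℕ} (ht : t ≤ n) (v : Fin (P.size t))
    (l : Fin k) (j : Fin (k - 1)) :
    (rectHi P t v j + if l = idx j then 1 else 0) ≤ rectHi P (t + 1) (P.step t v l) j := by
  obtain ⟨x, hx, hc⟩ := exists_rectHi hP ht v j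
  rw [← hc, ← countK_update, ← hx, ← P.state_update]
  exact le_rectHi rfl j

variable (P) in
/-- The largest distance `∑ b_j - ∑ x_j` from `x` to the upper corner of a rectangle of
layer `t` containing `x`. -/
noncomputable def potential (t : ℕ) (x : Fin (k - 1) → ℕ) : ℕ :=
  univ.sup fun v : Fin (P.size t) =>
    if ∀ j, rectLo P t v j ≤ x j ∧ x j ≤ rectHi P t v j then
      ∑ j, rectHi P t v j - ∑ j, x j
    else 0

theorem le_potential {t : ℕ} {x : Fin (k - 1) → ℕ} (v : Fin (P.size t))
    (hv : ∀ j, rectLo P t v j ≤ x j ∧ x j ≤ rectHi P t v j) :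
    ∑ j, rectHi P t v j - ∑ j, x j ≤ potential P t x := by
  have h := Finset.le_sup (f := fun v : Fin (P.size t) =>
    if ∀ j, rectLo P t v j ≤ x j ∧ x j ≤ rectHi P t v j then
      ∑ j, rectHi P t v j - ∑ j, x j else 0) (mem_univ v)
  rwa [if_pos hv] at h

theorem exists_potential_eq (hk : 1 ≤ k) {t : ℕ} {x : Fin (k - 1) → ℕ} (hx : x ∈ Tset k t) :
    ∃ v : Fin (P.size t), (∀ j, rectLo P t v j ≤ x j ∧ x j ≤ rectHi P t v j) ∧
      potential P t x = ∑ j, rectHi P t v j - ∑ j, x j := by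
  obtain ⟨v, -, hv⟩ := Finset.exists_mem_eq_sup univ ⟨⟨0, P.sizePos t⟩, mem_univ _⟩
    (fun v : Fin (P.size t) => if ∀ j, rectLo P t v j ≤ x j ∧ x j ≤ rectHi P t v j then
      ∑ j, rectHi P t v j - ∑ j, x j else 0)
  change potential P t x = _ at hv
  by_cases h : ∀ j, rectLo P t v j ≤ x j ∧ x j ≤ rectHi P t v j
  · exact ⟨v, h, by rw [hv, if_pos h]⟩
  · rw [if_neg h] at hv
    obtain ⟨w, hw⟩ := exists_countK_eq hk t x (mem_Tset.1 hx)
    have hmem : ∀ j, rectLo P t (P.state w t) j ≤ x j ∧ x j ≤ rectHi P t (P.state w t) j :=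
      fun j => hw j ▸ ⟨rectLo_le rfl j, le_rectHi rfl j⟩
    exact ⟨_, hmem, by have := le_potential _ hmem; omega⟩

/-- From one layer to the next the potential of a point strictly increases, unless the point is
the lower corner of some rectangle. -/
theorem potential_succ_le (hk : 1 ≤ k) (hP : P.Reachable) {t : ℕ} (ht : t ≤ n)
    {x : Fin (k - 1) → ℕ} (hx : x ∈ Tset k t) :
    potential P t x + 1 ≤ potential P (t + 1) x +
      if x ∈ univ.image (rectLo P t) then 1 else 0 := by
  obtain ⟨v, hv, hpot⟩ := exists_potential_eq (P := P) hk hx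
  by_cases hcorner : ∀ j, x j = rectLo P t v j
  · have hx' : x ∈ univ.image (rectLo P t) :=
      mem_image.2 ⟨v, mem_univ _, (funext hcorner).symm⟩
    rw [if_pos hx', hpot]
    have hlast : ∀ j : Fin (k - 1), (⟨k - 1, by omega⟩ : Fin k) ≠ idx j := by
      intro j h
      have := congrArg Fin.val h
      simp [idx] at this
      omega
    have hlo := rectLo_step_le hP ht v ⟨k - 1, by omega⟩
    have hhi := rectHi_add_le_step hP ht v ⟨k - 1, by omega⟩
    simp only [hlast, if_false, add_zero] at hlo hhi
    have hle := le_potential (P := P) (x := x) (P.step t v ⟨k - 1, by omega⟩)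
      fun j => ⟨(hlo j).trans (hv j).1, (hv j).2.trans (hhi j)⟩
    have := Finset.sum_le_sum fun j (_ : j ∈ univ) => hhi j
    omega
  · push Not at hcorner
    obtain ⟨i, hi⟩ := hcorner
    have hlo := rectLo_step_le hP ht v (idx i)
    have hhi := rectHi_add_le_step hP ht v (idx i)
    simp only [idx_injective.eq_iff] at hlo hhi
    have hle := le_potential (P := P) (x := x) (P.step t v (idx i)) fun j => by
      refine ⟨(hlo j).trans ?_, (hv j).2.trans ((Nat.le_add_right _ _).trans (hhi j))⟩
      split_ifs with hij
      · subst hij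
        have := (hv i).1
        omega
      · exact (hv j).1
    have hs := Finset.sum_le_sum fun j (_ : j ∈ univ) => hhi j
    rw [Finset.sum_add_distrib, Finset.sum_ite_eq, if_pos (mem_univ i)] at hs
    have := Finset.sum_le_sum fun j (_ : j ∈ univ) => (hv j).2
    omega

theorem sum_potential_succ_le (hk : 1 ≤ k) (hP : P.Reachable) {t : ℕ} (ht : t ≤ n) :
    ∑ x ∈ Tset k t, potential P t x + (Tset k t).card ≤
      ∑ x ∈ Tset k (t + 1), potential P (t + 1) x + P.size t := by
  have h1 := Finset.sum_le_sum fun x (hx : x ∈ Tset k t) => potential_succ_le hk hP ht hx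
  rw [Finset.sum_add_distrib, Finset.sum_add_distrib, ← Finset.sum_filter,
    ← Finset.card_eq_sum_ones, ← Finset.card_eq_sum_ones] at h1
  have h2 : ∑ x ∈ Tset k t, potential P (t + 1) x ≤
      ∑ x ∈ Tset k (t + 1), potential P (t + 1) x :=
    Finset.sum_le_sum_of_subset fun x hx => mem_Tset.2 ((mem_Tset.1 hx).trans (Nat.le_succ t))
  have h3 : ((Tset k t).filter fun x => x ∈ univ.image (rectLo P t)).card ≤ P.size t := by
    calc _ ≤ (univ.image (rectLo P t)).card :=
          card_le_card fun x hx => (mem_filter.1 hx).2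
      _ ≤ _ := card_image_le.trans_eq (by simp)
  omega

theorem ROBP.size_le_width_s17 {σ Out : Type} {n : ℕ} (P : ROBP σ Out n) {t : ℕ} (ht : t ≤ n) :
    P.size t ≤ P.width :=
  Finset.le_sup (f := P.size) (mem_range.2 (Nat.lt_succ_of_le ht))

theorem sum_card_Tset_le (hk : 1 ≤ k) (hP : P.Reachable) (s d : ℕ) (h : s + d ≤ n) :
    ∑ i ∈ range d, (Tset k (s + i)).card ≤
      ∑ x ∈ Tset k (s + d), potential P (s + d) x + d * P.width := by
  induction d with
  | zero => simp
  | succ d ih =>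
    have h1 := ih (by omega)
    have h2 := sum_potential_succ_le hk hP (t := s + d) (by omega)
    have h3 := P.size_le_width_s17 (t := s + d) (by omega)
    rw [sum_range_succ, add_mul, ← add_assoc s d 1]
    omega

theorem potential_le {Δ : ℝ} (hk : 1 ≤ k) (hP : P.Reachable) (hc : ComputesApproxCountK k n Δ P)
    {x : Fin (k - 1) → ℕ} (hx : x ∈ Tset k n) :
    (potential P n x : ℝ) ≤ (k - 1 : ℕ) * (2 * Δ) := by
  obtain ⟨v, hv, hpot⟩ := exists_potential_eq (P := P) hk hx
  rw [hpot, Nat.cast_sub (Finset.sum_le_sum fun j _ => (hv j).2), Nat.cast_sum, Nat.cast_sum,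
    ← Finset.sum_sub_distrib]
  refine (Finset.sum_le_card_nsmul univ _ (2 * Δ) fun j _ => ?_).trans_eq (by simp)
  obtain ⟨y, hy, hyc⟩ := exists_rectLo hP le_rfl v j
  obtain ⟨z, hz, hzc⟩ := exists_rectHi hP le_rfl v j
  have h1 := abs_le.1 (hc y (idx j))
  have h2 := abs_le.1 (hc z (idx j))
  rw [ROBP.eval, hy, hyc] at h1
  rw [ROBP.eval, hz, hzc] at h2
  have h3 : (rectLo P n v j : ℝ) ≤ x j := Nat.cast_le.2 (hv j).1
  linarith [h1.1, h1.2, h2.1, h2.2]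

/-- The potential argument: layers whose simplex is larger than the width force potential. -/
theorem sum_choose_le {Δ : ℝ} (hk : 1 ≤ k) (hP : P.Reachable)
    (hc : ComputesApproxCountK k n Δ P) (s d : ℕ) (h : s + d = n) :
    ∑ i ∈ range d, ((s + i + (k - 1)).choose (k - 1) : ℝ) ≤
      (n + (k - 1)).choose (k - 1) * ((k - 1 : ℕ) * (2 * Δ)) + d * P.width := by
  have h1 := sum_card_Tset_le hk hP s d h.le
  rw [h] at h1
  have h2 : ∑ x ∈ Tset k n, (potential P n x : ℝ) ≤
      (Tset k n).card • ((k - 1 : ℕ) * (2 * Δ)) :=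
    Finset.sum_le_card_nsmul _ _ _ fun x hx => potential_le hk hP hc hx
  simp only [card_Tset] at h1 h2
  rw [nsmul_eq_mul] at h2
  have h3 := (Nat.cast_le (α := ℝ)).2 h1
  push_cast at h3
  linarith

end Potential

section Numerics

variable {k n : ℕ} {Δ : ℝ}

theorem one_sub_pow_le_inv {u : ℝ} (h0 : 0 ≤ u) (h1 : u ≤ 1) (m : ℕ) :
    (1 - u) ^ m ≤ (1 + m * u)⁻¹ := by
  have hpos : 0 < 1 + m * u := by positivity
  rw [← one_div, le_div_iff₀ hpos]
  calc (1 - u) ^ m * (1 + m * u) ≤ (1 - u) ^ m * (1 + u) ^ m := by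
        gcongr
        · exact one_add_mul_le_pow (by linarith) m
    _ = (1 - u ^ 2) ^ m := by rw [← mul_pow]; congr 1; ring
    _ ≤ 1 := pow_le_one₀ (by nlinarith) (by nlinarith)

theorem sum_range_sub (L : ℕ) : ∑ i ∈ range L, ((L : ℝ) - i) = L * (L + 1) / 2 := by
  rw [Finset.sum_sub_distrib, sum_const, card_range, nsmul_eq_mul]
  have : ∑ i ∈ range L, (i : ℝ) = L * (L - 1) / 2 := by
    induction L with
    | zero => simp
    | succ L ih => rw [sum_range_succ, ih]; push_cast; ring
  rw [this]
  ring

/-- The basic size relations between `k`, `n`, `Δ` and `√(nΔ)` in the regime `Δ ≤ n/(10k²)`. -/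
theorem sqrt_bounds (hk : 2 ≤ k) (hΔ : 10 ≤ Δ) (hn : Δ ≤ (n : ℝ) / (10 * (k : ℝ) ^ 2)) :
    √(n * Δ) ^ 2 = n * Δ ∧ 60 ≤ √(n * Δ) ∧ 3.16 * k * √(n * Δ) ≤ n ∧
      3.16 * k * Δ ≤ √(n * Δ) ∧ 200 * (k : ℝ) ≤ n := by
  have hk' : (2 : ℝ) ≤ k := by exact_mod_cast hk
  have hn' : Δ * (10 * (k : ℝ) ^ 2) ≤ n := (le_div_iff₀ (by positivity)).1 hn
  have hn0 : (0 : ℝ) ≤ n := Nat.cast_nonneg n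
  have hsq : √(n * Δ) ^ 2 = n * Δ := Real.sq_sqrt (by positivity)
  have hs0 : 0 ≤ √(n * Δ) := Real.sqrt_nonneg _
  have hkn : 100 * (k : ℝ) ^ 2 ≤ n := by nlinarith [sq_nonneg (k : ℝ)]
  have hlow : 3.16 * k * Δ ≤ √(n * Δ) := by
    apply Real.le_sqrt_of_sq_le
    nlinarith [mul_le_mul_of_nonneg_right hn' (by linarith : 0 ≤ Δ), sq_nonneg (k * Δ)]
  refine ⟨hsq, by nlinarith, ?_, hlow, by nlinarith⟩
  refine abs_le_of_sq_le_sq' ?_ hn0 |>.2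
  nlinarith [mul_le_mul_of_nonneg_left hn' hn0, sq_nonneg (k * √(n * Δ))]

/-- Every program computing `ApproxCount_k[n,Δ]` satisfies the width lower bound. -/
theorem genChoose_le_width {P : ROBP (Fin k) (Fin k → ℝ) n} (hk : 2 ≤ k) (hΔ : 10 ≤ Δ)
    (hn : Δ ≤ (n : ℝ) / (10 * (k : ℝ) ^ 2)) (hP : P.Reachable)
    (hc : ComputesApproxCountK k n Δ P) :
    genChoose ((n : ℝ) + (k : ℝ) - 1 - 6 * √(n * Δ)) (k - 1) ≤ (P.width : ℝ) := by
  obtain ⟨hsq, hs, hsn, -, hkn⟩ := sqrt_bounds hk hΔ hn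
  set s := √(n * Δ)
  by_contra! hlt
  obtain ⟨m, rfl⟩ : ∃ m, k = m + 1 := ⟨k - 1, by omega⟩
  have hm : (1 : ℝ) ≤ m := by exact_mod_cast (show 1 ≤ m by omega)
  have hx : (n : ℝ) + ((m + 1 : ℕ) : ℝ) - 1 = n + m := by push_cast; ring
  rw [hx, Nat.add_sub_cancel] at hlt
  push_cast at hsn hkn
  have hn0 : (0 : ℝ) < n := by linarith
  have hsn1 : 6.32 * s ≤ n := by nlinarith
  have hL1 : 2 * s ≤ ⌈2 * s⌉₊ := Nat.le_ceil _
  have hL2 : (⌈2 * s⌉₊ : ℝ) < 2 * s + 1 := Nat.ceil_lt_add_one (by linarith)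
  set L := ⌈2 * s⌉₊
  have hLn : L ≤ n := by
    have : (L : ℝ) ≤ n := by linarith
    exact_mod_cast this
  have hpot := sum_choose_le (by omega) hP hc (n - L) L (by omega)
  rw [Nat.add_sub_cancel] at hpot
  have hF := genChoose_natCast n m
  have hFpos : 0 < genChoose ((n : ℝ) + m) m := by
    rw [hF]
    exact_mod_cast Nat.choose_pos (by omega)
  rw [← hF] at hpot
  set F := genChoose ((n : ℝ) + m) m
  have hsum : F * (L - m * (L * (L + 1) / 2) / n) ≤
      ∑ i ∈ range L, ((n - L + i + m).choose m : ℝ) := by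
    have hterm : ∀ i ∈ range L, F * (1 - m * ((L : ℝ) - i) / n) ≤
        ((n - L + i + m).choose m : ℝ) := by
      intro i hi
      have hi' : (i : ℝ) ≤ L := by exact_mod_cast (mem_range.1 hi).le
      have hLn' : (L : ℝ) ≤ n := by exact_mod_cast hLn
      have hi0 : (0 : ℝ) ≤ i := Nat.cast_nonneg i
      rw [← genChoose_natCast (n - L + i) m]
      have e : (((n - L + i : ℕ) : ℝ) + m) = (n + m) - (L - i) := by
        rw [Nat.cast_add, Nat.cast_sub hLn]
        ring
      rw [e]
      exact genChoose_sub_ge hn0 (by linarith) (by linarith) (by linarith)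
    refine le_trans (le_of_eq ?_) (Finset.sum_le_sum hterm)
    rw [← Finset.mul_sum, Finset.sum_sub_distrib, ← Finset.sum_div, ← Finset.mul_sum,
      sum_range_sub]
    simp
  have hw : (P.width : ℝ) < F * (1 + m * (6 * s / (n + m)))⁻¹ := by
    refine hlt.trans_le ((genChoose_sub_le (by linarith) (by linarith) (by linarith)).trans ?_)
    refine mul_le_mul_of_nonneg_left (one_sub_pow_le_inv (by positivity) ?_ m) hFpos.le
    rw [div_le_one (by linarith)]
    linarith
  have hinv : (1 + m * (6 * s / (n + m)))⁻¹ ≤ 1 - 2.06 * s * m / n := by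
    have hD : 0 < (n : ℝ) + m + 6 * s * m := by positivity
    have e : (1 + m * (6 * s / (n + m)))⁻¹ = 1 - 6 * s * m / (n + m + 6 * s * m) := by
      field_simp
      ring
    have hle : 2.06 * s * m / n ≤ 6 * s * m / (n + m + 6 * s * m) := by
      rw [div_le_div_iff₀ hn0 hD]
      have : 2.06 * (n + m + 6 * s * m) ≤ 6 * (n : ℝ) := by nlinarith
      have hsm : 0 ≤ s * m := by positivity
      nlinarith
    rw [e]
    linarith
  have hL0 : (0 : ℝ) < L := by linarith
  have hfin : F * (L - m * (L * (L + 1) / 2) / n) <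
      F * (m * (2 * Δ) + L * (1 - 2.06 * s * m / n)) := by
    have h1 := mul_lt_mul_of_pos_left (hw.trans_le (mul_le_mul_of_nonneg_left hinv hFpos.le)) hL0
    nlinarith
  have hfin' := lt_of_mul_lt_mul_left hfin hFpos.le
  have hmn : (m : ℝ) / n * (L * (2.06 * s - (L + 1) / 2)) < m / n * (2 * s ^ 2) := by
    have e1 : (m : ℝ) / n * (2 * s ^ 2) = m * (2 * Δ) := by
      rw [hsq]
      field_simp
    have e2 : (m : ℝ) / n * (L * (2.06 * s - (L + 1) / 2)) =
        L * (2.06 * s * m / n) - m * (L * (L + 1) / 2) / n := by ring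
    rw [e1, e2]
    linarith
  have hcontra := lt_of_mul_lt_mul_left hmn (by positivity)
  nlinarith [mul_le_mul_of_nonneg_right hL1 (by linarith : 0 ≤ 1.06 * s - 1)]

end Numerics

section Automaton

variable {σ Q : Type} (q₀ : Q) (δ : ℕ → Q → σ → Q)

/-- The state reached after `t` steps by an automaton with time-dependent transitions. -/
def runState (x : ℕ → σ) : ℕ → Q
  | 0 => q₀
  | t + 1 => δ t (runState x t) (x t)

theorem runState_congr {x y : ℕ → σ} {t : ℕ} (h : ∀ i < t, x i = y i) :
    runState q₀ δ x t = runState q₀ δ y t := by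
  induction t with
  | zero => rfl
  | succ t ih =>
    simp only [runState]
    rw [ih fun i hi => h i (by omega), h t (by omega)]

variable [Fintype σ] [DecidableEq Q]

/-- The states an automaton can be in after `t` steps. -/
def reachable : ℕ → Finset Q
  | 0 => {q₀}
  | t + 1 => (reachable t ×ˢ univ).image fun p => δ t p.1 p.2

theorem step_mem_reachable {t : ℕ} {q : Q} (hq : q ∈ reachable q₀ δ t) (l : σ) :
    δ t q l ∈ reachable q₀ δ (t + 1) :=
  mem_image.2 ⟨(q, l), mem_product.2 ⟨hq, mem_univ l⟩, rfl⟩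

theorem mem_reachable [Nonempty σ] {t : ℕ} {q : Q} :
    q ∈ reachable q₀ δ t ↔ ∃ x : ℕ → σ, runState q₀ δ x t = q := by
  induction t generalizing q with
  | zero => simp [reachable, runState, eq_comm]
  | succ t ih =>
    simp only [reachable, mem_image, mem_product, mem_univ, and_true, Prod.exists]
    constructor
    · rintro ⟨p, l, hp, rfl⟩
      obtain ⟨x, rfl⟩ := ih.1 hp
      refine ⟨Function.update x t l, ?_⟩
      have h : runState q₀ δ (Function.update x t l) t = runState q₀ δ x t :=
        runState_congr q₀ δ fun i hi => by rw [Function.update_of_ne (Nat.ne_of_lt hi)]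
      rw [runState, Function.update_self, h]
    · rintro ⟨x, rfl⟩
      exact ⟨_, x t, ih.2 ⟨x, rfl⟩, rfl⟩

theorem reachable_nonempty [Nonempty σ] (t : ℕ) : (reachable q₀ δ t).Nonempty :=
  ⟨_, (mem_reachable q₀ δ).2 ⟨fun _ => Classical.arbitrary σ, rfl⟩⟩

/-- The branching program whose layers are the reachable states of an automaton. -/
noncomputable def ROBP.ofAutomaton [Nonempty σ] {Out : Type} (n : ℕ) (out : Q → Out) :
    ROBP σ Out n where
  size t := (reachable q₀ δ t).card
  size0 := by simp [reachable]
  sizePos t := (reachable_nonempty q₀ δ t).card_pos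
  step t v l := (reachable q₀ δ (t + 1)).equivFin
    ⟨_, step_mem_reachable q₀ δ ((reachable q₀ δ t).equivFin.symm v).2 l⟩
  out v := out ((reachable q₀ δ n).equivFin.symm v)

variable [Nonempty σ] {Out : Type} {n : ℕ} (out : Q → Out)

theorem ROBP.equivFin_symm_state_ofAutomaton (x : ℕ → σ) (t : ℕ) :
    (((reachable q₀ δ t).equivFin.symm ((ROBP.ofAutomaton q₀ δ n out).state x t) : _) : Q) =
      runState q₀ δ x t := by
  induction t with
  | zero =>
    have h := ((reachable q₀ δ 0).equivFin.symm
      ((ROBP.ofAutomaton q₀ δ n out).state x 0)).2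
    exact mem_singleton.1 h
  | succ t ih =>
    simp only [ROBP.state, runState, ← ih]
    simp [ROBP.ofAutomaton]

theorem ROBP.eval_ofAutomaton (x : ℕ → σ) :
    (ROBP.ofAutomaton q₀ δ n out).eval x = out (runState q₀ δ x n) := by
  rw [← ROBP.equivFin_symm_state_ofAutomaton q₀ δ (n := n) out]
  rfl

theorem ROBP.reachable_ofAutomaton : (ROBP.ofAutomaton q₀ δ n out).Reachable := by
  intro t _ v
  obtain ⟨x, hx⟩ := (mem_reachable q₀ δ).1 ((reachable q₀ δ t).equivFin.symm v).2
  refine ⟨x, (reachable q₀ δ t).equivFin.symm.injective (Subtype.ext ?_)⟩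
  rw [ROBP.equivFin_symm_state_ofAutomaton, hx]

theorem ROBP.width_ofAutomaton_le {N : ℕ} (B : ℕ → Finset Q) (hB : ∀ t ≤ n, (B t).card ≤ N)
    (hrun : ∀ t ≤ n, ∀ x : ℕ → σ, runState q₀ δ x t ∈ B t) :
    (ROBP.ofAutomaton q₀ δ n out).width ≤ N := by
  refine Finset.sup_le fun t ht => ?_
  have ht' : t ≤ n := Nat.lt_succ_iff.1 (mem_range.1 ht)
  refine le_trans (card_le_card fun q hq => ?_) (hB t ht')
  obtain ⟨x, rfl⟩ := (mem_reachable q₀ δ).1 hq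
  exact hrun t ht' x

end Automaton

section Skipping

variable {k : ℕ}

/-- The alternating sign of a letter. -/
def letterSign (l : Fin k) : ℤ := if l.val % 2 = 0 then 1 else -1

theorem letterSign_eq (l : Fin k) : letterSign l = 1 ∨ letterSign l = -1 := by
  unfold letterSign
  split_ifs <;> simp

/-- The vector of signs of the first `k - 1` letters. -/
def signVec (k : ℕ) : Fin (k - 1) → ℤ := fun j => letterSign (idx j)

theorem sum_signVec (k : ℕ) : ∑ j, signVec k j = 0 ∨ ∑ j, signVec k j = 1 := by
  have h : ∀ m : ℕ, ∑ i ∈ range m, (if i % 2 = 0 then (1 : ℤ) else -1) = m % 2 := by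
    intro m
    induction m with
    | zero => rfl
    | succ m ih =>
      rw [sum_range_succ, ih]
      split_ifs <;> push_cast <;> omega
  have h2 := Fin.sum_univ_eq_sum_range (fun i => if i % 2 = 0 then (1 : ℤ) else -1) (k - 1)
  have h3 : ∑ j, signVec k j = ((k - 1 : ℕ) : ℤ) % 2 := by
    rw [← h, ← h2]
    rfl
  omega

/-- The alternating sum of the coordinates. -/
def height (z : Fin (k - 1) → ℤ) : ℤ := ∑ j, signVec k j * z j

theorem height_add (y z : Fin (k - 1) → ℤ) : height (y + z) = height y + height z := by
  simp [height, mul_add, Finset.sum_add_distrib]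

theorem height_smul_signVec (c : ℤ) : height (c • signVec k) = c * (k - 1 : ℕ) := by
  have h : ∀ j ∈ univ, signVec k j * (c • signVec k) j = c := by
    intro j _
    rcases letterSign_eq (idx j) with h | h <;> simp [signVec, h]
  rw [height, Finset.sum_congr rfl h]
  simp [mul_comm]

/-- The increment of the count vector caused by a letter. -/
def letterVec (l : Fin k) : Fin (k - 1) → ℤ := fun j => if l = idx j then 1 else 0

theorem height_letterVec (l : Fin k) :
    height (letterVec l) = 0 ∨ height (letterVec l) = letterSign l := by
  by_cases h : ∃ j, l = idx j
  · obtain ⟨i, rfl⟩ := h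
    right
    simp [height, letterVec, signVec, idx_injective.eq_iff]
  · left
    push Not at h
    simp [height, letterVec, h]

/-- The counts of the first `k - 1` letters. -/
def countVec (x : ℕ → Fin k) (t : ℕ) : Fin (k - 1) → ℤ := fun j => countK x t (idx j)

theorem countVec_succ (x : ℕ → Fin k) (t : ℕ) :
    countVec x (t + 1) = countVec x t + letterVec (x t) := by
  ext j
  simp [countVec, letterVec, countK_succ]

variable (k) in
/-- Exact counting up to time `T`; afterwards, states whose height is congruent modulo `D` to one
of the `k - 1` residues `r, …, r + k - 2` are skipped by moving along the sign vector. -/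
def skipStep (T D : ℕ) (r : ℤ) (t : ℕ) (z : Fin (k - 1) → ℤ) (l : Fin k) : Fin (k - 1) → ℤ :=
  if t < T ∨ ((k - 1 : ℕ) : ℤ) ≤ (height (z + letterVec l) - r) % D then z + letterVec l
  else z + letterVec l + letterSign l • signVec k

variable (k) in
/-- The state of the skipping counter after `t` steps. -/
def skipRun (T D : ℕ) (r : ℤ) : (ℕ → Fin k) → ℕ → Fin (k - 1) → ℤ :=
  runState 0 (skipStep k T D r)

variable {T D : ℕ} {r : ℤ}

theorem skipRun_of_le (x : ℕ → Fin k) {t : ℕ} (ht : t ≤ T) :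
    skipRun k T D r x t = countVec x t := by
  induction t with
  | zero =>
    ext j
    simp [skipRun, runState, countVec, countK]
  | succ t ih =>
    rw [countVec_succ, ← ih (by omega)]
    exact if_pos (Or.inl (by omega))

/-- The skipping counter differs from the true counts by a multiple of the sign vector, and that
multiple changes exactly when the height moves to another block of allowed residues. -/
theorem skipRun_invariant (hk : 2 ≤ k) (hD : 2 * (k - 1) ≤ D) (x : ℕ → Fin k) :
    ∃ c₀ : ℤ, |c₀| ≤ 1 ∧ ∃ K : ℤ, ∀ s : ℕ, ∃ c N ρ : ℤ,
      skipRun k T D r x (T + 1 + s) = countVec x (T + 1 + s) + c • signVec k ∧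
      height (skipRun k T D r x (T + 1 + s)) - r = D * N + ρ ∧ ((k - 1 : ℕ) : ℤ) ≤ ρ ∧ ρ < D ∧
      c = N + K ∧ (s = 0 → c = c₀) := by
  have hDz : (0 : ℤ) < D := by omega
  have hD2 : 2 * ((k - 1 : ℕ) : ℤ) ≤ D := by exact_mod_cast hD
  have hm0 : (0 : ℤ) ≤ ((k - 1 : ℕ) : ℤ) := Int.natCast_nonneg _
  have hrun : ∀ t, skipRun k T D r x (t + 1) = skipStep k T D r t (skipRun k T D r x t) (x t) :=
    fun t => rfl
  have hbase : ∃ c N ρ : ℤ,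
      skipRun k T D r x (T + 1) = countVec x (T + 1) + c • signVec k ∧
      height (skipRun k T D r x (T + 1)) - r = D * N + ρ ∧ ((k - 1 : ℕ) : ℤ) ≤ ρ ∧ ρ < D ∧
      |c| ≤ 1 := by
    have hcv : skipRun k T D r x T + letterVec (x T) = countVec x (T + 1) := by
      rw [skipRun_of_le x le_rfl, countVec_succ]
    rw [hrun, skipStep, hcv]
    have hdiv := Int.mul_ediv_add_emod (height (countVec x (T + 1)) - r) D
    have h0 := Int.emod_nonneg (height (countVec x (T + 1)) - r) hDz.ne'
    have h1 := Int.emod_lt_of_pos (height (countVec x (T + 1)) - r) hDz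
    split_ifs with h
    · exact ⟨0, _, _, by simp, hdiv.symm, by simpa using h, h1, by simp⟩
    · rw [not_or, not_le] at h
      rw [height_add, height_smul_signVec]
      rcases letterSign_eq (x T) with hl | hl <;> rw [hl]
      · refine ⟨1, (height (countVec x (T + 1)) - r) / D,
          (height (countVec x (T + 1)) - r) % D + (k - 1 : ℕ), rfl, ?_, ?_, ?_, ?_⟩
        · linarith
        · linarith
        · linarith [h.2]
        · simp
      · refine ⟨-1, (height (countVec x (T + 1)) - r) / D - 1,
          (height (countVec x (T + 1)) - r) % D - (k - 1 : ℕ) + D, rfl, ?_, ?_, ?_, ?_⟩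
        · linarith
        · linarith
        · linarith [h.2]
        · simp
  obtain ⟨c₀, N₀, ρ₀, hz, hh, hρ, hρ', hc⟩ := hbase
  refine ⟨c₀, hc, c₀ - N₀, fun s => ?_⟩
  induction s with
  | zero => exact ⟨c₀, N₀, ρ₀, hz, hh, hρ, hρ', by ring, fun _ => rfl⟩
  | succ s ih =>
    obtain ⟨c, N, ρ, hz, hh, hρ, hρ', hc, -⟩ := ih
    rw [← add_assoc (T + 1) s 1, hrun, skipStep, countVec_succ]
    set z := skipRun k T D r x (T + 1 + s)
    set l := x (T + 1 + s)
    have hadd : height (z + letterVec l) - r = D * N + (ρ + height (letterVec l)) := by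
      rw [height_add]
      linarith
    have hmod : (height (z + letterVec l) - r) % D = (ρ + height (letterVec l)) % D := by
      rw [hadd, Int.mul_add_emod_self_left]
    have hcv : z + letterVec l = countVec x (T + 1 + s) + letterVec l + c • signVec k := by
      rw [hz]
      abel
    have hδ : height (letterVec l) = 0 ∨ height (letterVec l) = letterSign l :=
      height_letterVec l
    by_cases hok : ((k - 1 : ℕ) : ℤ) ≤ ρ + height (letterVec l) ∧
        ρ + height (letterVec l) < D
    · rw [if_pos]
      · exact ⟨c, N, _, hcv, hadd, hok.1, hok.2, hc, by omega⟩
      · right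
        rw [hmod, Int.emod_eq_of_lt (by linarith [hok.1]) hok.2]
        exact hok.1
    · have hcross : (letterSign l = 1 ∧ ρ + height (letterVec l) = D) ∨
          (letterSign l = -1 ∧ ρ + height (letterVec l) = (k - 1 : ℕ) - 1) := by
        rcases letterSign_eq l with hl | hl <;> rcases hδ with h | h <;> rw [h] at hok ⊢ <;>
          omega
      have hm1 : (1 : ℤ) ≤ ((k - 1 : ℕ) : ℤ) := by omega
      have hbad : ¬ (T + 1 + s < T ∨
          ((k - 1 : ℕ) : ℤ) ≤ (height (z + letterVec l) - r) % D) := by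
        rw [hmod]
        rcases hcross with ⟨-, h⟩ | ⟨-, h⟩ <;> rw [h]
        · rw [Int.emod_self]
          omega
        · rw [Int.emod_eq_of_lt (by linarith) (by linarith)]
          omega
      rw [if_neg hbad, height_add (z + letterVec l), height_smul_signVec]
      rcases hcross with ⟨hl, h⟩ | ⟨hl, h⟩
      · refine ⟨c + 1, N + 1, (k - 1 : ℕ), ?_, ?_, le_rfl, by linarith, by linarith, by omega⟩
        · rw [hcv, hl, add_smul, add_assoc]
        · rw [hl]
          linarith
      · refine ⟨c - 1, N - 1, D - 1, ?_, ?_, by linarith, by linarith, by linarith, by omega⟩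
        · rw [hcv, hl, sub_eq_add_neg, add_smul, add_assoc]
        · rw [hl]
          linarith

theorem abs_height_countVec_sub_le (x : ℕ → Fin k) (t s : ℕ) :
    |height (countVec x (t + s)) - height (countVec x t)| ≤ s := by
  induction s with
  | zero => simp
  | succ s ih =>
    rw [← add_assoc, countVec_succ, height_add]
    have h := height_letterVec (x (t + s))
    have h' := letterSign_eq (x (t + s))
    push_cast
    rw [abs_le] at ih ⊢
    omega

/-- The error of the skipping counter is bounded in terms of the number of steps after `T`. -/
theorem skipRun_eq (hk : 2 ≤ k) (hD : 2 * (k - 1) ≤ D) {L e : ℕ}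
    (hLD : L + D < (D - (k - 1)) * e) (x : ℕ → Fin k) {t : ℕ} (ht : t ≤ T + L) :
    ∃ c : ℤ, |c| ≤ e ∧ skipRun k T D r x t = countVec x t + c • signVec k ∧
      (T < t → ((k - 1 : ℕ) : ℤ) ≤ (height (skipRun k T D r x t) - r) % D) := by
  obtain h | h := le_or_gt t T
  · exact ⟨0, by simp, by simp [skipRun_of_le x h], by omega⟩
  obtain ⟨s, rfl⟩ : ∃ s, t = T + 1 + s := ⟨t - (T + 1), by omega⟩
  obtain ⟨c₀, hc₀, K, hK⟩ := skipRun_invariant (T := T) (r := r) hk hD x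
  obtain ⟨a, N₀, ρ₀, hz₀, hh₀, hρ₀, hρ₀', ha, hac⟩ := hK 0
  obtain ⟨c, N, ρ, hz, hh, hρ, hρ', hc, -⟩ := hK s
  obtain rfl := hac rfl
  refine ⟨c, ?_, hz, fun _ => ?_⟩
  · have hcnt := abs_height_countVec_sub_le x (T + 1) s
    rw [hz₀, height_add, height_smul_signVec, add_zero] at hh₀
    rw [hz, height_add, height_smul_signVec] at hh
    have hLDz : (L : ℤ) + D < (D - (k - 1 : ℕ)) * e := by
      have := (Nat.cast_lt (α := ℤ)).2 hLD
      rwa [Nat.cast_mul, Nat.cast_sub (by omega), Nat.cast_add] at this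
    have hs : (s : ℤ) ≤ L := by omega
    have hpos : 0 < (D : ℤ) - (k - 1 : ℕ) := by omega
    have hdiff : ((D : ℤ) - (k - 1 : ℕ)) * (c - a) =
        (height (countVec x (T + 1 + s)) - height (countVec x (T + 1))) + (ρ₀ - ρ) := by
      rw [ha] at hh₀ ⊢
      rw [hc] at hh ⊢
      linear_combination hh₀ - hh
    have hm0 : (0 : ℤ) ≤ ((k - 1 : ℕ) : ℤ) := Int.natCast_nonneg _
    rw [abs_le] at hcnt hc₀ ⊢
    have h1 : c - a < e := by
      refine lt_of_mul_lt_mul_left (a := (D : ℤ) - (k - 1 : ℕ)) ?_ hpos.le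
      rw [hdiff]
      linarith [hcnt.2]
    have h2 : -(e : ℤ) < c - a := by
      refine lt_of_mul_lt_mul_left (a := (D : ℤ) - (k - 1 : ℕ)) ?_ hpos.le
      rw [hdiff, mul_neg]
      linarith [hcnt.1]
    omega
  · rw [hh, Int.mul_add_emod_self_left, Int.emod_eq_of_lt (by omega) hρ']
    exact hρ

end Skipping

section UpperBound

variable {k n T D e : ℕ} {Δ : ℝ}

/-- Averaging over the offset: some choice of `m` consecutive residues is skipped by at most
its fair share of a finite set. -/
theorem exists_offset {α : Type*} (S : Finset α) (g : α → ℤ) {D m : ℕ} (hD : 0 < D) :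
    ∃ r : ℤ, D * (S.filter fun u => (m : ℤ) ≤ (g u - r) % D).card ≤ (D - m) * S.card := by
  have hDz : (0 : ℤ) < D := by exact_mod_cast hD
  have hcard : ∀ a : ℤ, ((range D).filter fun i : ℕ => (m : ℤ) ≤ (a - i) % D).card ≤ D - m := by
    intro a
    rw [← Nat.card_Ico]
    refine card_le_card_of_injOn (fun i => ((a - i) % D).toNat) (fun i hi => ?_)
      fun i hi j hj hij => ?_
    · have h0 := Int.emod_nonneg (a - i) hDz.ne'
      have h1 := Int.emod_lt_of_pos (a - i) hDz
      have h2 := (mem_filter.1 hi).2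
      rw [coe_Ico, Set.mem_Ico]
      dsimp only
      omega
    · have hi0 := Int.emod_nonneg (a - i) hDz.ne'
      have hj0 := Int.emod_nonneg (a - j) hDz.ne'
      have hiD := mem_range.1 (mem_filter.1 hi).1
      have hjD := mem_range.1 (mem_filter.1 hj).1
      have hmod : (a - i) % D = (a - j) % D := by
        dsimp only at hij
        omega
      have h := (Int.emod_eq_emod_iff_emod_sub_eq_zero.1 hmod)
      obtain ⟨q, hq⟩ := Int.dvd_of_emod_eq_zero h
      have hq1 : q < 1 := by nlinarith
      have hq2 : -1 < q := by nlinarith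
      obtain rfl : q = 0 := by omega
      omega
  have hsum : ∑ i ∈ range D, D * (S.filter fun u => (m : ℤ) ≤ (g u - i) % D).card ≤
      ∑ _i ∈ range D, (D - m) * S.card := by
    rw [← Finset.mul_sum, sum_const, card_range, smul_eq_mul]
    refine Nat.mul_le_mul_left D ?_
    have hswap := Finset.sum_card_bipartiteAbove_eq_sum_card_bipartiteBelow
      (fun (i : ℕ) u => (m : ℤ) ≤ (g u - i) % D) (s := range D) (t := S)
    unfold Finset.bipartiteAbove Finset.bipartiteBelow at hswap
    rw [hswap, mul_comm]
    exact Finset.sum_le_card_nsmul _ _ _ fun u _ => hcard (g u)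
  obtain ⟨i, -, hi⟩ := Finset.exists_le_of_sum_le (nonempty_range_iff.2 hD.ne') hsum
  exact ⟨i, hi⟩

theorem sum_countVec_le (x : ℕ → Fin k) (t : ℕ) : ∑ j, countVec x t j ≤ t := by
  unfold countVec
  exact_mod_cast sum_countK_idx_le x t

theorem sum_add_smul_signVec (y : Fin (k - 1) → ℤ) (c : ℤ) :
    |∑ j, (y + c • signVec k) j - ∑ j, y j| ≤ |c| := by
  have h : ∑ j, (y + c • signVec k) j - ∑ j, y j = c * ∑ j, signVec k j := by
    simp [Finset.sum_add_distrib, Finset.mul_sum]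
  rw [h]
  rcases sum_signVec k with h | h <;> simp [h]

/-- The output of the skipping counter: the last letter is counted by complement. -/
noncomputable def skipOut (k n : ℕ) (z : Fin (k - 1) → ℤ) (l : Fin k) : ℝ :=
  if h : l.val < k - 1 then z ⟨l, h⟩ else n - ∑ j, (z j : ℝ)

theorem abs_skipOut_sub_le (x : ℕ → Fin k) {c : ℤ} (l : Fin k) :
    |skipOut k n (countVec x n + c • signVec k) l - countK x n l| ≤ |(c : ℝ)| := by
  unfold skipOut
  split_ifs with h
  · have hl : idx ⟨l, h⟩ = l := rfl
    rcases letterSign_eq l with h1 | h1 <;> simp [countVec, signVec, hl, h1]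
  · have hl : l = ⟨k - 1, by omega⟩ := Fin.ext (by simp; omega)
    have h1 := sum_countK x n
    rw [sum_eq_sum_idx_add (by omega), ← hl] at h1
    have h2 : ∑ j, (countVec x n j : ℝ) + countK x n l = n := by
      simp only [countVec, Int.cast_natCast]
      exact_mod_cast h1
    have h3 := (Int.cast_le (R := ℝ)).2 (sum_add_smul_signVec (countVec x n) c)
    rw [Int.cast_abs, Int.cast_abs, Int.cast_sub, Int.cast_sum, Int.cast_sum] at h3
    rw [← h2, abs_sub_comm]
    refine le_of_eq_of_le (congrArg _ ?_) h3
    ring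

theorem exists_program (hk : 2 ≤ k) (hT : T ≤ n) (hD : 2 * (k - 1) ≤ D)
    (hLD : (n - T) + D < (D - (k - 1)) * e) (he : (e : ℝ) ≤ Δ) {N : ℕ}
    (hNT : (T + (k - 1)).choose (k - 1) ≤ N)
    (hND : (D - (k - 1)) * (n + k * e + (k - 1)).choose (k - 1) < D * (N + 1)) :
    ∃ P : ROBP (Fin k) (Fin k → ℝ) n, P.Reachable ∧ ComputesApproxCountK k n Δ P ∧
      P.width ≤ N := by
  have : Nonempty (Fin k) := ⟨⟨0, by omega⟩⟩
  let lift : (Fin (k - 1) → ℕ) → Fin (k - 1) → ℤ := fun u j => (u j : ℤ) - e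
  obtain ⟨r, hr⟩ := exists_offset (Tset k (n + k * e)) (fun u => height (lift u))
    (m := k - 1) (show 0 < D by omega)
  rw [card_Tset] at hr
  have hspec : ∀ x : ℕ → Fin k, ∀ t ≤ n, _ := fun x t ht =>
    skipRun_eq (T := T) (r := r) hk hD hLD x (show t ≤ T + (n - T) by omega)
  let B : ℕ → Finset (Fin (k - 1) → ℤ) := fun t =>
    if t ≤ T then (Tset k T).image fun u j => (u j : ℤ)
    else ((Tset k (n + k * e)).filter fun u =>
      ((k - 1 : ℕ) : ℤ) ≤ (height (lift u) - r) % D).image lift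
  refine ⟨ROBP.ofAutomaton 0 (skipStep k T D r) n (skipOut k n),
    ROBP.reachable_ofAutomaton _ _ _, fun x l => ?_,
    ROBP.width_ofAutomaton_le _ _ _ B (fun t _ => ?_) fun t ht x => ?_⟩
  · obtain ⟨c, hc, hz, -⟩ := hspec x n le_rfl
    rw [ROBP.eval_ofAutomaton]
    change |skipOut k n (skipRun k T D r x n) l - _| ≤ _
    rw [hz]
    refine (abs_skipOut_sub_le x l).trans (le_trans ?_ he)
    exact_mod_cast hc
  · dsimp only [B]
    split_ifs
    · exact card_image_le.trans ((card_Tset k T).trans_le hNT)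
    · refine card_image_le.trans (Nat.lt_succ_iff.1 (lt_of_mul_lt_mul_left (a := D) ?_ D.zero_le))
      exact hr.trans_lt hND
  · obtain ⟨c, hc, hz, hmod⟩ := hspec x t ht
    change skipRun k T D r x t ∈ B t
    dsimp only [B]
    split_ifs with htT
    · rw [skipRun_of_le x htT]
      exact mem_image.2 ⟨fun j => countK x t (idx j),
        mem_Tset.2 ((sum_countK_idx_le x t).trans htT), rfl⟩
    · have hlow : ∀ j, 0 ≤ skipRun k T D r x t j + e := by
        intro j
        rw [hz]
        have h0 : 0 ≤ countVec x t j := Int.natCast_nonneg _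
        rw [abs_le] at hc
        rcases letterSign_eq (idx j) with h | h <;> simp [signVec, h] <;> omega
      have hlift : lift (fun j => (skipRun k T D r x t j + e).toNat) = skipRun k T D r x t := by
        ext j
        simp only [lift, Int.toNat_of_nonneg (hlow j)]
        ring
      refine mem_image.2 ⟨_, mem_filter.2 ⟨mem_Tset.2 ?_, ?_⟩, hlift⟩
      · have h1 := sum_countVec_le x t
        have h2 := sum_add_smul_signVec (countVec x t) c
        rw [← hz] at h2
        zify
        simp only [Int.toNat_of_nonneg (hlow _)]
        rw [Finset.sum_add_distrib]
        have h3 : (((k - 1 : ℕ) : ℤ)) = k - 1 := by omega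
        simp only [sum_const, card_univ, Fintype.card_fin, nsmul_eq_mul, h3]
        rw [abs_le] at h2
        have ht' : (t : ℤ) ≤ n := by exact_mod_cast ht
        linarith [h2.2]
      · rw [hlift]
        exact hmod (by omega)

theorem sub_mul_choose_le {n d m : ℕ} {D y : ℝ} (hn : (0 : ℝ) < n) (hD : 0 < D) (hy : 0 ≤ y)
    (hdy : d + y ≤ n) (hdD : (d + y) * D ≤ n) :
    (D - m) * ((n + d + m).choose m : ℝ) ≤ D * genChoose ((n : ℝ) + m - y) m := by
  have h := genChoose_sub_ge (x := ((n + d : ℕ) : ℝ) + m) (y := d + y) (m := m) hn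
    (by positivity) hdy (by push_cast; linarith [(Nat.cast_nonneg d : (0 : ℝ) ≤ d)])
  have hx : ((n + d : ℕ) : ℝ) + m - (d + y) = n + m - y := by
    push_cast
    ring
  rw [hx, genChoose_natCast] at h
  refine le_trans ?_ (mul_le_mul_of_nonneg_left h hD.le)
  rw [mul_left_comm, mul_comm]
  refine mul_le_mul_of_nonneg_left ?_ (Nat.cast_nonneg _)
  have h1 : (m : ℝ) * (d + y) / n * D ≤ m := by
    rw [div_mul_eq_mul_div, div_le_iff₀ hn, mul_assoc]
    exact mul_le_mul_of_nonneg_left hdD (Nat.cast_nonneg m)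
  linarith

set_option maxHeartbeats 1000000 in
/-- The width upper bound for `ApproxCount_k[n,Δ]`. -/
theorem exists_program_genChoose (hk : 2 ≤ k) (hΔ : 10 ≤ Δ)
    (hn : Δ ≤ (n : ℝ) / (10 * (k : ℝ) ^ 2)) :
    ∃ P : ROBP (Fin k) (Fin k → ℝ) n, P.Reachable ∧ ComputesApproxCountK k n Δ P ∧
      (P.width : ℝ) ≤ genChoose ((n : ℝ) + (k : ℝ) - 1 - 1 / 10 * √(n * Δ)) (k - 1) := by
  obtain ⟨hsq, hs, hsn, hsΔ, hkn⟩ := sqrt_bounds hk hΔ hn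
  set s := √(n * Δ)
  have hk' : (2 : ℝ) ≤ k := by exact_mod_cast hk
  have hm : ((k - 1 : ℕ) : ℝ) = k - 1 := by rw [Nat.cast_sub (by omega), Nat.cast_one]
  have hn0 : (0 : ℝ) < n := by linarith
  have hs0 : 0 < s := by linarith
  have hsn1 : 6.32 * s ≤ n := by nlinarith
  have hx : (n : ℝ) + (k : ℝ) - 1 - 1 / 10 * s = n + (k - 1 : ℕ) - 1 / 10 * s := by rw [hm]; ring
  rw [hx]
  have hL1 : 1 / 10 * s ≤ ⌈1 / 10 * s⌉₊ := Nat.le_ceil _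
  have hL2 : (⌈1 / 10 * s⌉₊ : ℝ) < 1 / 10 * s + 1 := Nat.ceil_lt_add_one (by linarith)
  set L := ⌈1 / 10 * s⌉₊
  have hLn : L ≤ n := by
    have : (L : ℝ) ≤ n := by linarith
    exact_mod_cast this
  have hD1 : (⌊2 * n / s⌋₊ : ℝ) ≤ 2 * n / s := Nat.floor_le (by positivity)
  have hD2 : 2 * n / s < ⌊2 * n / s⌋₊ + 1 := Nat.lt_floor_add_one _
  set D := ⌊2 * n / s⌋₊
  have hDs : (D : ℝ) * s ≤ 2 * n := (le_div_iff₀ hs0).1 hD1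
  have hDs' : 2 * (n : ℝ) < (D + 1) * s := (div_lt_iff₀ hs0).1 hD2
  have hDk : 5 * (k - 1 : ℝ) ≤ D := by
    have : 6.32 * k < (D : ℝ) + 1 := by
      refine lt_of_mul_lt_mul_right (a := s) ?_ hs0.le
      linarith
    linarith
  have he1 : (⌊Δ⌋₊ : ℝ) ≤ Δ := Nat.floor_le (by linarith)
  have he2 : Δ < ⌊Δ⌋₊ + 1 := Nat.lt_floor_add_one _
  set e := ⌊Δ⌋₊
  have hDk2 : 5 * (k - 1) ≤ D := by
    rw [← hm] at hDk
    exact_mod_cast hDk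
  have hDpos : (0 : ℝ) < D := by linarith
  have hLD : (n - (n - L)) + D < (D - (k - 1)) * e := by
    rw [Nat.sub_sub_self hLn, ← Nat.cast_lt (α := ℝ), Nat.cast_add, Nat.cast_mul,
      Nat.cast_sub (by omega), hm]
    have h1 : 4 / 5 * (D : ℝ) ≤ D - (k - 1) := by linarith
    have h2 : 4 / 5 * (D : ℝ) * (9 / 10 * Δ) ≤ (D - (k - 1)) * e :=
      mul_le_mul h1 (by linarith) (by positivity) (by linarith)
    have h3 : 2 * s < (D + 1) * Δ := by
      refine lt_of_mul_lt_mul_right (a := s) ?_ hs0.le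
      nlinarith
    nlinarith
  set g := genChoose ((n : ℝ) + (k - 1 : ℕ) - 1 / 10 * s) (k - 1)
  have hg : ((n - L + (k - 1)).choose (k - 1) : ℝ) ≤ g := by
    rw [← genChoose_natCast, Nat.cast_sub hLn]
    refine genChoose_mono ?_ (by linarith)
    have : (L : ℝ) ≤ n := by exact_mod_cast hLn
    linarith
  have hg0 : 0 ≤ g := le_trans (Nat.cast_nonneg _) hg
  have hke : (k : ℝ) * e + 1 / 10 * s ≤ 1 / 2 * s := by nlinarith
  have hgD : ((D : ℝ) - (k - 1 : ℕ)) * ((n + k * e + (k - 1)).choose (k - 1) : ℝ) ≤ D * g :=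
    sub_mul_choose_le hn0 hDpos (by linarith) (by push_cast; linarith) (by
      push_cast
      linarith [mul_le_mul_of_nonneg_right hke hDpos.le])
  have hND : (D - (k - 1)) * (n + k * e + (k - 1)).choose (k - 1) < D * (⌊g⌋₊ + 1) := by
    rw [← Nat.cast_lt (α := ℝ), Nat.cast_mul, Nat.cast_mul, Nat.cast_sub (by omega),
      Nat.cast_add_one]
    exact hgD.trans_lt (mul_lt_mul_of_pos_left (Nat.lt_floor_add_one g) hDpos)
  obtain ⟨P, hP, hc, hw⟩ := exists_program hk (Nat.sub_le n L) (by omega) hLD he1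
    (Nat.le_floor hg) hND
  exact ⟨P, hP, hc, (Nat.cast_le.2 hw).trans (Nat.floor_le hg0)⟩

end UpperBound

/-- there are absolute constants `c₁, c₂ > 0` such that for all
`k ≥ 2`, `n ≥ 10k` and `10 ≤ Δ ≤ n/(10k²)`,
`C(n + k - 1 - c₂·√(nΔ), k-1) ≤ w(k,n,Δ) ≤ C(n + k - 1 - c₁·√(nΔ), k-1)`. -/
theorem stmt17 :
    ∃ c₁ c₂ : ℝ, 0 < c₁ ∧ 0 < c₂ ∧
      ∀ k n : ℕ, 2 ≤ k → 10 * k ≤ n →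
        ∀ Δ : ℝ, 10 ≤ Δ → Δ ≤ (n : ℝ) / (10 * (k : ℝ) ^ 2) →
          genChoose ((n : ℝ) + (k : ℝ) - 1 - c₂ * Real.sqrt ((n : ℝ) * Δ)) (k - 1) ≤
              (widthOpt k n Δ : ℝ) ∧
          (widthOpt k n Δ : ℝ) ≤
            genChoose ((n : ℝ) + (k : ℝ) - 1 - c₁ * Real.sqrt ((n : ℝ) * Δ)) (k - 1) := by
  refine ⟨1 / 10, 6, by norm_num, by norm_num, fun k n hk _ Δ hΔ hn => ?_⟩
  obtain ⟨P, hP, hc, hw⟩ := exists_program_genChoose hk hΔ hn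
  have hne : {w : ℕ | ∃ P : ROBP (Fin k) (Fin k → ℝ) n, P.Reachable ∧
      ComputesApproxCountK k n Δ P ∧ P.width = w}.Nonempty := ⟨_, P, hP, hc, rfl⟩
  obtain ⟨P', hP', hc', hw'⟩ := Nat.sInf_mem hne
  refine ⟨?_, le_trans (Nat.cast_le.2 (Nat.sInf_le ⟨P, hP, hc, rfl⟩)) hw⟩
  rw [widthOpt, ← hw']
  exact genChoose_le_width hk hΔ hn hP' hc'
end
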